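/- arXiv:1005.3257 — 6 statements merged into one kernel-verified Lean document; each statement's English description precedes it below -/
import Mathlib

section
/- (Theorem of Section 3.3, part (a).) For every subset Λ ⊆ {1,…,p}, the n+p endomorphisms in the family M_Λ pairwise commute: for any two members F and G of M_Λ one has F ∘ G = G ∘ F. In particular, the families {g_1,…,g_n, mul(t_1−f_1),…,mul(t_p−f_p)} and {g_1,…,g_n, σ_1,…,σ_p} each consist of pairwise commuting endomorphisms of R. -/
open MvPolynomial

variable {K : Type*} [Field K] [CharZero K] {n p : ℕ}

/-- The multiplication-by-`g` endomorphism of `K[x_1,…,x_n,t_1,…,t_p]`. -/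
noncomputable def mulOp (g : MvPolynomial (Fin n ⊕ Fin p) K) :
    Module.End K (MvPolynomial (Fin n ⊕ Fin p) K) :=
  LinearMap.mulLeft K g

/-- The partial-derivative endomorphism with respect to the variable `v`. -/
noncomputable def pd (v : Fin n ⊕ Fin p) :
    Module.End K (MvPolynomial (Fin n ⊕ Fin p) K) :=
  (pderiv v).toLinearMap

/-- The operator `g_i = ∂x_i + Σ_j mul(∂f_j/∂x_i) ∘ ∂t_j`. -/
noncomputable def gOp (f : Fin p → MvPolynomial (Fin n ⊕ Fin p) K) (i : Fin n) :
    Module.End K (MvPolynomial (Fin n ⊕ Fin p) K) :=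
  pd (Sum.inl i) + ∑ j : Fin p, mulOp (pderiv (Sum.inl i) (f j)) * pd (Sum.inr j)

/-- The operator `σ_j = mul(f_j − t_j) ∘ ∂t_j − id`, the image of `s_j + f_j ∂t_j`
under the representation sending `s_j` to `−t_j ∂t_j − 1`. -/
noncomputable def sigmaOp (f : Fin p → MvPolynomial (Fin n ⊕ Fin p) K) (j : Fin p) :
    Module.End K (MvPolynomial (Fin n ⊕ Fin p) K) :=
  mulOp (f j - X (Sum.inr j)) * pd (Sum.inr j) - 1

open Classical in
/-- The family `M_Λ` of `n + p` endomorphisms: `g_1,…,g_n` together with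
`mul(t_k − f_k)` for `k ∈ Λ` and `σ_j` for `j ∉ Λ`. -/
noncomputable def MFam (f : Fin p → MvPolynomial (Fin n ⊕ Fin p) K) (Λ : Set (Fin p)) :
    Fin n ⊕ Fin p → Module.End K (MvPolynomial (Fin n ⊕ Fin p) K) :=
  Sum.elim (gOp f) fun j => if j ∈ Λ then mulOp (X (Sum.inr j) - f j) else sigmaOp f j

section

variable {K : Type*} [Field K] {n p : ℕ}

/-- The operator `g_i` as a derivation. -/
noncomputable def gDerivation (f : Fin p → MvPolynomial (Fin n ⊕ Fin p) K) (i : Fin n) :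
    Derivation K (MvPolynomial (Fin n ⊕ Fin p) K) (MvPolynomial (Fin n ⊕ Fin p) K) :=
  pderiv (Sum.inl i) + ∑ j : Fin p, pderiv (Sum.inl i) (f j) • pderiv (Sum.inr j)

theorem gDerivation_apply (f : Fin p → MvPolynomial (Fin n ⊕ Fin p) K) (i : Fin n)
    (q : MvPolynomial (Fin n ⊕ Fin p) K) :
    gDerivation f i q = pderiv (Sum.inl i) q +
      ∑ j : Fin p, pderiv (Sum.inl i) (f j) * pderiv (Sum.inr j) q := by
  rw [gDerivation, Derivation.add_apply, ← Derivation.coeFnAddMonoidHom_apply (∑ j, _), map_sum,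
    Finset.sum_apply]
  rfl

theorem gOp_eq_gDerivation (f : Fin p → MvPolynomial (Fin n ⊕ Fin p) K) (i : Fin n) :
    gOp f i = (gDerivation f i).toLinearMap := by
  refine LinearMap.ext fun q => ?_
  refine Eq.trans ?_ (gDerivation_apply f i q).symm
  simp [gOp, mulOp, pd]

/-- Derivations of a polynomial ring commute as soon as they commute on the variables. -/
theorem commute_derivation_of_forall_X {σ : Type*}
    {D E : Derivation K (MvPolynomial σ K) (MvPolynomial σ K)}
    (h : ∀ v, D (E (X v)) = E (D (X v))) :
    Commute (D.toLinearMap : Module.End K (MvPolynomial σ K)) E.toLinearMap := by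
  have h_lie : ⁅D, E⁆ = 0 := derivation_ext fun v => by
    rw [Derivation.commutator_apply, h v, sub_self, Derivation.zero_apply]
  refine LinearMap.ext fun q => ?_
  have hq := congrArg (fun F => F q) h_lie
  rw [Derivation.commutator_apply] at hq
  exact sub_eq_zero.mp hq

theorem commute_pd (v w : Fin n ⊕ Fin p) :
    Commute (pd v : Module.End K (MvPolynomial (Fin n ⊕ Fin p) K)) (pd w) := by
  classical
  refine commute_derivation_of_forall_X fun u => ?_
  simp only [pderiv_X, Pi.single_apply]
  split_ifs <;> simp

theorem pderiv_pderiv_comm (v w : Fin n ⊕ Fin p) (q : MvPolynomial (Fin n ⊕ Fin p) K) :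
    pderiv v (pderiv w q) = pderiv w (pderiv v q) :=
  LinearMap.congr_fun (commute_pd v w).eq q

theorem commute_mulOp_mulOp (g h : MvPolynomial (Fin n ⊕ Fin p) K) :
    Commute (mulOp g) (mulOp h) :=
  LinearMap.ext fun q => mul_left_comm g h q

theorem commute_derivation_mulOp
    {D : Derivation K (MvPolynomial (Fin n ⊕ Fin p) K) (MvPolynomial (Fin n ⊕ Fin p) K)}
    {g : MvPolynomial (Fin n ⊕ Fin p) K} (h : D g = 0) :
    Commute (D.toLinearMap : Module.End K (MvPolynomial (Fin n ⊕ Fin p) K)) (mulOp g) := by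
  refine LinearMap.ext fun q => ?_
  change D (g * q) = g * D q
  simp [h]

theorem pderiv_inr_eq_zero {q : MvPolynomial (Fin n ⊕ Fin p) K}
    (hq : q ∈ supported K (Set.range Sum.inl)) (j : Fin p) :
    pderiv (Sum.inr j) q = 0 := by
  refine pderiv_eq_zero_of_notMem_vars fun hj => ?_
  obtain ⟨i, hi⟩ := mem_supported.mp hq hj
  exact Sum.inl_ne_inr hi

variable {f : Fin p → MvPolynomial (Fin n ⊕ Fin p) K}

theorem gDerivation_X_inl (i k : Fin n) :
    gDerivation f i (X (Sum.inl k)) = C (if k = i then 1 else 0) := by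
  classical
  rw [gDerivation_apply]
  simp [pderiv_X, Pi.single_apply, apply_ite C]

theorem gDerivation_X_inr (i : Fin n) (k : Fin p) :
    gDerivation f i (X (Sum.inr k)) = pderiv (Sum.inl i) (f k) := by
  classical
  rw [gDerivation_apply]
  simp [pderiv_X, Pi.single_apply]

theorem gDerivation_eq_pderiv {q : MvPolynomial (Fin n ⊕ Fin p) K}
    (hq : ∀ j, pderiv (Sum.inr j) q = 0) (i : Fin n) :
    gDerivation f i q = pderiv (Sum.inl i) q := by
  simp [gDerivation_apply, hq]

theorem pderiv_inr_pderiv_eq_zero {q : MvPolynomial (Fin n ⊕ Fin p) K} {j : Fin p}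
    (hq : pderiv (Sum.inr j) q = 0) (v : Fin n ⊕ Fin p) :
    pderiv (Sum.inr j) (pderiv v q) = 0 := by
  rw [pderiv_pderiv_comm, hq, map_zero]

theorem commute_gOp_gOp (hf : ∀ j k, pderiv (Sum.inr j) (f k) = 0) (i k : Fin n) :
    Commute (gOp f i) (gOp f k) := by
  rw [gOp_eq_gDerivation, gOp_eq_gDerivation]
  refine commute_derivation_of_forall_X fun v => ?_
  rcases v with l | l
  · simp only [gDerivation_X_inl, derivation_C]
  · simp only [gDerivation_X_inr]
    rw [gDerivation_eq_pderiv fun j => pderiv_inr_pderiv_eq_zero (hf j l) _,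
      gDerivation_eq_pderiv fun j => pderiv_inr_pderiv_eq_zero (hf j l) _, pderiv_pderiv_comm]

theorem commute_gOp_pd_inr (hf : ∀ j k, pderiv (Sum.inr j) (f k) = 0) (i : Fin n) (j : Fin p) :
    Commute (gOp f i) (pd (Sum.inr j)) := by
  classical
  rw [gOp_eq_gDerivation]
  refine commute_derivation_of_forall_X fun v => ?_
  rcases v with l | l
  · rw [gDerivation_X_inl, pderiv_C]
    simp
  · rw [gDerivation_X_inr, pderiv_inr_pderiv_eq_zero (hf j l), pderiv_X, Pi.single_apply]
    split_ifs <;> simp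

theorem commute_gOp_mulOp (hf : ∀ j k, pderiv (Sum.inr j) (f k) = 0) (i : Fin n) (k : Fin p) :
    Commute (gOp f i) (mulOp (X (Sum.inr k) - f k)) := by
  rw [gOp_eq_gDerivation]
  refine commute_derivation_mulOp ?_
  rw [map_sub, gDerivation_X_inr, gDerivation_eq_pderiv fun j => hf j k, sub_self]

theorem commute_pd_inr_mulOp (hf : ∀ j k, pderiv (Sum.inr j) (f k) = 0) {j k : Fin p}
    (hjk : j ≠ k) :
    Commute (pd (Sum.inr j)) (mulOp (X (Sum.inr k) - f k)) := by
  refine commute_derivation_mulOp ?_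
  rw [map_sub, hf, pderiv_X_of_ne (Sum.inr_injective.ne hjk.symm), sub_zero]

theorem sigmaOp_eq (j : Fin p) :
    sigmaOp f j = -(mulOp (X (Sum.inr j) - f j) * pd (Sum.inr j)) - 1 := by
  refine LinearMap.ext fun q => ?_
  change (f j - X (Sum.inr j)) * _ - q = -((X (Sum.inr j) - f j) * _) - q
  rw [← neg_mul, neg_sub]

/-- An operator commuting with `mul(t_j - f_j)` and `∂t_j` commutes with `σ_j`. -/
theorem commute_sigmaOp {F : Module.End K (MvPolynomial (Fin n ⊕ Fin p) K)} {j : Fin p}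
    (h_mul : Commute F (mulOp (X (Sum.inr j) - f j))) (h_pd : Commute F (pd (Sum.inr j))) :
    Commute F (sigmaOp f j) := by
  rw [sigmaOp_eq]
  exact (h_mul.mul_right h_pd).neg_right.sub_right (Commute.one_right F)

theorem commute_sigmaOp_mulOp (hf : ∀ j k, pderiv (Sum.inr j) (f k) = 0) {j k : Fin p}
    (hjk : j ≠ k) : Commute (sigmaOp f j) (mulOp (X (Sum.inr k) - f k)) :=
  (commute_sigmaOp (commute_mulOp_mulOp _ _) (commute_pd_inr_mulOp hf hjk).symm).symm

theorem commute_sigmaOp_sigmaOp (hf : ∀ j k, pderiv (Sum.inr j) (f k) = 0) (j k : Fin p) :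
    Commute (sigmaOp f j) (sigmaOp f k) := by
  rcases eq_or_ne j k with rfl | hjk
  · exact Commute.refl _
  · exact commute_sigmaOp (commute_sigmaOp_mulOp hf hjk)
      (commute_sigmaOp (commute_pd_inr_mulOp hf hjk.symm) (commute_pd _ _)).symm

end

/-- Theorem (Section 3.3, part (a)): for every subset `Λ ⊆ {1,…,p}`, the members of
the family `M_Λ` pairwise commute.  In particular (taking `Λ = univ` resp. `Λ = ∅`),
the families `G ∪ T` and `G ∪ S` consist of pairwise commuting endomorphisms. -/
theorem MFam_mul_comm (hn : 0 < n) (hp : 0 < p)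
    (f : Fin p → MvPolynomial (Fin n ⊕ Fin p) K)
    (hf : ∀ j, f j ∈ MvPolynomial.supported K (Set.range Sum.inl))
    (Λ : Set (Fin p)) (a b : Fin n ⊕ Fin p) :
    MFam f Λ a * MFam f Λ b = MFam f Λ b * MFam f Λ a := by
  have hf' : ∀ j k, pderiv (Sum.inr j) (f k) = 0 := fun j k => pderiv_inr_eq_zero (hf k) j
  have h_inl_inr : ∀ i j, Commute (MFam f Λ (Sum.inl i)) (MFam f Λ (Sum.inr j)) := by
    intro i j
    simp only [MFam, Sum.elim_inl, Sum.elim_inr]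
    split_ifs
    · exact commute_gOp_mulOp hf' i j
    · exact commute_sigmaOp (commute_gOp_mulOp hf' i j) (commute_gOp_pd_inr hf' i j)
  rcases a with i | j <;> rcases b with k | l
  · exact commute_gOp_gOp hf' i k
  · exact h_inl_inr i l
  · exact (h_inl_inr k j).symm
  · simp only [MFam, Sum.elim_inr]
    split_ifs with hj hl hl
    · exact commute_mulOp_mulOp _ _
    · exact (commute_sigmaOp_mulOp hf' (ne_of_mem_of_not_mem hj hl).symm).symm
    · exact commute_sigmaOp_mulOp hf' (ne_of_mem_of_not_mem hl hj).symm
    · exact commute_sigmaOp_sigmaOp hf' j l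
end

section
/- (Theorem of Section 3.3, part (a), the exceptional commutator.) For all 1 ≤ j, k ≤ p one has mul(t_k − f_k) ∘ σ_j − σ_j ∘ mul(t_k − f_k) = mul(t_k − f_k) if j = k, and mul(t_k − f_k) ∘ σ_j − σ_j ∘ mul(t_k − f_k) = 0 if j ≠ k; that is, the commutator [t_k − f_k, s_j + f_j ∂t_j] equals δ_{jk}·(t_k − f_k) as operators on R. -/
open MvPolynomial

variable {K : Type*} [Field K] [CharZero K] {n p : ℕ}

theorem pderiv_inr_eq_zero_of_mem_supported_inl {R σ τ : Type*} [CommSemiring R]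
    {g : MvPolynomial (σ ⊕ τ) R} (hg : g ∈ supported R (Set.range Sum.inl)) (j : τ) :
    pderiv (Sum.inr j) g = 0 := by
  refine pderiv_eq_zero_of_notMem_vars fun h => ?_
  obtain ⟨i, hi⟩ := mem_supported.mp hg h
  exact Sum.inl_ne_inr hi

/-- Theorem (Section 3.3, part (a), the exceptional commutator): as operators on `R`,
`[t_k − f_k, s_j + f_j ∂t_j] = δ_{jk} · (t_k − f_k)`. -/
theorem commutator_tk_sigma (hn : 0 < n) (hp : 0 < p)
    (f : Fin p → MvPolynomial (Fin n ⊕ Fin p) K)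
    (hf : ∀ j, f j ∈ MvPolynomial.supported K (Set.range Sum.inl))
    (j k : Fin p) :
    mulOp (X (Sum.inr k) - f k) * sigmaOp f j - sigmaOp f j * mulOp (X (Sum.inr k) - f k) =
      if j = k then mulOp (X (Sum.inr k) - f k) else 0 := by
  refine LinearMap.ext fun g => ?_
  have hfk := pderiv_inr_eq_zero_of_mem_supported_inl (hf k) j
  split_ifs with hjk
  · subst hjk
    simp only [mulOp, sigmaOp, pd, LinearMap.sub_apply, Module.End.mul_apply,
      LinearMap.mulLeft_apply, Module.End.one_apply, Derivation.coeFn_coe,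
      Derivation.leibniz, map_sub, pderiv_X_self, hfk, smul_eq_mul]
    ring
  · have hX : pderiv (Sum.inr j) (X (Sum.inr k) : MvPolynomial (Fin n ⊕ Fin p) K) = 0 :=
      pderiv_X_of_ne fun h => hjk (Sum.inr_injective h).symm
    simp only [mulOp, sigmaOp, pd, LinearMap.sub_apply, Module.End.mul_apply,
      LinearMap.mulLeft_apply, Module.End.one_apply, Derivation.coeFn_coe,
      Derivation.leibniz, map_sub, hX, hfk, smul_eq_mul,
      LinearMap.zero_apply]
    ring
end

section
/- (Lemma 5.7.) Let J be a left ideal of A and s ∈ A such that a·s ∈ J for every a ∈ J (i.e. J·s ⊆ J). If the K-algebra End_A(A⧸J) of left-A-module endomorphisms of A⧸J is finite-dimensional over K, then J ∩ K[s] ≠ {0}: there exists a nonzero polynomial p ∈ K[X] with aeval s p ∈ J. -/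
/-- Right multiplication by `s`, as an endomorphism of the left module `A ⧸ J`, when `J·s ⊆ J`. -/
def Submodule.quotientMulRight {A : Type*} [Ring A] (J : Submodule A A) (s : A)
    (hJs : ∀ a ∈ J, a * s ∈ J) : Module.End A (A ⧸ J) :=
  J.mapQ J (LinearMap.toSpanSingleton A A s) hJs

theorem Submodule.quotientMulRight_mk {A : Type*} [Ring A] (J : Submodule A A) (s : A)
    (hJs : ∀ a ∈ J, a * s ∈ J) (a : A) :
    J.quotientMulRight s hJs (Submodule.Quotient.mk a) = Submodule.Quotient.mk (a * s) :=
  rfl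

theorem Submodule.aeval_quotientMulRight_mk {K A : Type*} [Field K] [Ring A] [Algebra K A]
    (J : Submodule A A) (s : A) (hJs : ∀ a ∈ J, a * s ∈ J) (p : Polynomial K) (a : A) :
    Polynomial.aeval (J.quotientMulRight s hJs) p (Submodule.Quotient.mk a) =
      Submodule.Quotient.mk (a * Polynomial.aeval s p) := by
  induction p using Polynomial.induction_on' generalizing a with
  | add p q hp hq => simp [hp, hq, mul_add]
  | monomial n c =>
    have hpow (n : ℕ) (a : A) : (J.quotientMulRight s hJs ^ n) (Submodule.Quotient.mk a) =
        Submodule.Quotient.mk (a * s ^ n) := by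
      induction n generalizing a with
      | zero => simp
      | succ n ih =>
        rw [pow_succ, Module.End.mul_apply, quotientMulRight_mk, ih, mul_assoc, pow_succ']
    rw [Polynomial.aeval_monomial, Polynomial.aeval_monomial, Module.End.mul_apply, hpow,
      Module.algebraMap_end_apply, ← Algebra.smul_def, mul_smul_comm, Submodule.Quotient.mk_smul]

/-- Lemma 5.7: if `J` is a left ideal of a unital associative `K`-algebra `A` with
`J·s ⊆ J`, and the `K`-algebra of left-`A`-module endomorphisms of `A⧸J` is finite
dimensional over `K`, then `J ∩ K[s] ≠ {0}`: some nonzero polynomial in `s` lies in `J`. -/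
theorem exists_nonzero_poly_mem_of_finiteDimensional_end
    {K A : Type*} [Field K] [Ring A] [Algebra K A]
    (J : Submodule A A) (s : A) (hJs : ∀ a ∈ J, a * s ∈ J)
    (hfin : FiniteDimensional K (Module.End A (A ⧸ J))) :
    ∃ p : Polynomial K, p ≠ 0 ∧ Polynomial.aeval s p ∈ J := by
  obtain ⟨p, hp, hp0⟩ := Algebra.IsAlgebraic.isAlgebraic (R := K) (J.quotientMulRight s hJs)
  refine ⟨p, hp, ?_⟩
  have h := J.aeval_quotientMulRight_mk s hJs p 1
  rwa [hp0, LinearMap.zero_apply, one_mul, eq_comm, Submodule.Quotient.mk_eq_zero] at h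
end

section
/- (Refinement from the proof of Lemma 5.7: the monic generator of J ∩ K[s] is a minimal polynomial.) Let J be a left ideal of A and s ∈ A with a·s ∈ J for every a ∈ J, and assume End_A(A⧸J) is finite-dimensional over K. Then right multiplication by s induces a well-defined left-A-module endomorphism φ of A⧸J (φ sends the class of a to the class of a·s), and for every p ∈ K[X] one has: aeval s p ∈ J if and only if the minimal polynomial of φ over K divides p. In particular, {p ∈ K[X] : p(s) ∈ J} is the ideal of K[X] generated by the minimal polynomial of φ. -/
/-- If an endomorphism `φ` of `A ⧸ J` is induced by right multiplication by `s`, then `p(φ)` is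
induced by right multiplication by `p(s)`. -/
theorem aeval_apply_mk_of_apply_mk
    {K A : Type*} [CommSemiring K] [Ring A] [Algebra K A] {J : Submodule A A} {s : A}
    {φ : Module.End A (A ⧸ J)}
    (hφ : ∀ a : A, φ (Submodule.Quotient.mk a) = Submodule.Quotient.mk (a * s))
    (p : Polynomial K) (a : A) :
    Polynomial.aeval φ p (Submodule.Quotient.mk a) =
      Submodule.Quotient.mk (a * Polynomial.aeval s p) := by
  have hpow (n : ℕ) : (φ ^ n) (Submodule.Quotient.mk a) = Submodule.Quotient.mk (a * s ^ n) := by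
    induction n with
    | zero => simp
    | succ n ih => rw [pow_succ', Module.End.mul_apply, ih, hφ, mul_assoc, ← pow_succ]
  induction p using Polynomial.induction_on' with
  | add p q hp hq =>
    rw [map_add, map_add, LinearMap.add_apply, hp, hq, mul_add, Submodule.Quotient.mk_add]
  | monomial n c =>
    rw [Polynomial.aeval_monomial, Polynomial.aeval_monomial, ← Algebra.smul_def,
      ← Algebra.smul_def, LinearMap.smul_apply, hpow, mul_smul_comm, Submodule.Quotient.mk_smul]


/-- Refinement from the proof of Lemma 5.7: under the hypotheses of Lemma 5.7, right
multiplication by `s` induces a well-defined left-`A`-module endomorphism `φ` of `A⧸J`,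
and for `p ∈ K[X]` one has `p(s) ∈ J` iff the minimal polynomial of `φ` over `K`
divides `p`; so `{p : p(s) ∈ J}` is the ideal generated by the minimal polynomial of `φ`. -/
theorem aeval_mem_iff_minpoly_dvd
    {K A : Type*} [Field K] [Ring A] [Algebra K A]
    (J : Submodule A A) (s : A) (hJs : ∀ a ∈ J, a * s ∈ J)
    (hfin : FiniteDimensional K (Module.End A (A ⧸ J))) :
    ∃ φ : Module.End A (A ⧸ J),
      (∀ a : A, φ (Submodule.Quotient.mk a) = Submodule.Quotient.mk (a * s)) ∧
      ∀ p : Polynomial K, Polynomial.aeval s p ∈ J ↔ minpoly K φ ∣ p := by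
  let φ : Module.End A (A ⧸ J) := J.mapQ J (LinearMap.toSpanSingleton A A s) hJs
  have hφ (a : A) : φ (Submodule.Quotient.mk a) = Submodule.Quotient.mk (a * s) := rfl
  refine ⟨φ, hφ, fun p => ?_⟩
  rw [minpoly.dvd_iff]
  constructor
  · intro hp
    refine LinearMap.ext fun x => ?_
    obtain ⟨a, rfl⟩ := Submodule.Quotient.mk_surjective J x
    rw [aeval_apply_mk_of_apply_mk hφ, LinearMap.zero_apply, Submodule.Quotient.mk_eq_zero]
    exact J.smul_mem a hp
  · intro hp
    rw [← Submodule.Quotient.mk_eq_zero, ← one_mul (Polynomial.aeval s p),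
      ← aeval_apply_mk_of_apply_mk hφ, hp, LinearMap.zero_apply]
end

section
/- (Theorem 8.1, the checkRoot principle.) Let s ∈ A be central (a·s = s·a for all a ∈ A) and suppose the evaluation map K[X] → A, p ↦ aeval s p, is injective (so K[s] is a polynomial subring contained in the center of A). Let I be a left ideal of A with I ∩ K[s] ≠ {0} (there exists a nonzero p₀ ∈ K[X] with aeval s p₀ ∈ I), and let q ∈ K[X]. Then (I + A·q(s)) ∩ K[s] = I ∩ K[s] + K[s]·q(s); explicitly, for every p ∈ K[X], aeval s p lies in the left ideal I ⊔ Submodule.span A {aeval s q} if and only if there exist u, v ∈ K[X] with p = u + v·q and aeval s u ∈ I. -/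
open Polynomial in
theorem Commute.aeval_right {R A : Type*} [CommSemiring R] [Semiring A] [Algebra R A]
    {a s : A} (h : Commute a s) (p : R[X]) : Commute a (aeval s p) := by
  induction p using Polynomial.induction_on' with
  | add p r hp hr => simpa using hp.add_right hr
  | monomial n c =>
    rw [aeval_monomial]
    exact (Algebra.commute_algebraMap_right c a).mul_right (h.pow_right n)

open Polynomial in
/-- The polynomials whose value at `s` lies in the left ideal `I`. -/
def Polynomial.evalContraction {R A : Type*} [CommSemiring R] [Semiring A] [Algebra R A]
    (s : A) (I : Submodule A A) : Ideal R[X] where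
  carrier := {p | aeval s p ∈ I}
  add_mem' hp hr := by simpa using I.add_mem hp hr
  zero_mem' := by simp
  smul_mem' c p hp := by simpa using I.smul_mem (aeval s c) hp


/-- Theorem 8.1 (the `checkRoot` principle): let `s ∈ A` be central with `K[s] ≅ K[X]`
(the evaluation map is injective), let `I` be a left ideal of `A` with
`I ∩ K[s] ≠ {0}`, and let `q ∈ K[X]`.  Then
`(I + A·q(s)) ∩ K[s] = I ∩ K[s] + K[s]·q(s)`: explicitly, `p(s)` lies in the left
ideal `I + A·q(s)` iff `p = u + v·q` with `u(s) ∈ I`. -/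
theorem checkRoot_principle
    {K A : Type*} [Field K] [Ring A] [Algebra K A]
    (s : A) (hcentral : ∀ a : A, a * s = s * a)
    (hinj : Function.Injective fun p : Polynomial K => Polynomial.aeval s p)
    (I : Submodule A A)
    (hI : ∃ p₀ : Polynomial K, p₀ ≠ 0 ∧ Polynomial.aeval s p₀ ∈ I)
    (q : Polynomial K) :
    ∀ p : Polynomial K,
      Polynomial.aeval s p ∈ I ⊔ Submodule.span A {Polynomial.aeval s q} ↔
        ∃ u v : Polynomial K, p = u + v * q ∧ Polynomial.aeval s u ∈ I := by
  intro p
  constructor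
  · intro hp
    obtain ⟨i, hi, y, hy, hiy⟩ := Submodule.mem_sup.1 hp
    obtain ⟨a, rfl⟩ := Submodule.mem_span_singleton.1 hy
    obtain ⟨b, hb⟩ := IsPrincipalIdealRing.principal
      (Polynomial.evalContraction s I : Ideal (Polynomial K))
    have mem_iff (r : Polynomial K) : Polynomial.aeval s r ∈ I ↔ b ∣ r := by
      rw [← Ideal.mem_span_singleton]
      exact SetLike.ext_iff.1 hb r
    obtain ⟨p₀, hp₀, hp₀I⟩ := hI
    have hb0 : b ≠ 0 := ne_zero_of_dvd_ne_zero hp₀ ((mem_iff p₀).1 hp₀I)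
    classical
    obtain ⟨b', hb'⟩ := EuclideanDomain.gcd_dvd_left b q
    obtain ⟨q', hq'⟩ := EuclideanDomain.gcd_dvd_right b q
    have hbez := EuclideanDomain.gcd_eq_gcd_ab b q
    set d := EuclideanDomain.gcd b q
    have hb'0 : b' ≠ 0 := by
      rintro rfl
      exact hb0 (by simpa using hb')
    have hswap : b' * q = q' * b := by
      rw [hb', hq']
      ring
    have hmem : Polynomial.aeval s (b' * p) ∈ I := by
      have hcomm : Polynomial.aeval s b' * a = a * Polynomial.aeval s b' :=
        (Commute.aeval_right (hcentral a) b').symm.eq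
      have heq : Polynomial.aeval s (b' * p) = Polynomial.aeval s b' * i
          + (a * Polynomial.aeval s q') * Polynomial.aeval s b := by
        rw [map_mul, ← hiy, mul_add, smul_eq_mul, ← mul_assoc, hcomm, mul_assoc, mul_assoc,
          ← map_mul, ← map_mul, hswap]
      rw [heq]
      exact I.add_mem (I.smul_mem _ hi) (I.smul_mem _ ((mem_iff b).2 dvd_rfl))
    have hdvd : b' * d ∣ b' * p := by
      rw [mul_comm b' d, ← hb']
      exact (mem_iff _).1 hmem
    obtain ⟨c, rfl⟩ := (mul_dvd_mul_iff_left hb'0).1 hdvd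
    refine ⟨b * (EuclideanDomain.gcdA b q * c), EuclideanDomain.gcdB b q * c, ?_,
      (mem_iff _).2 (dvd_mul_right _ _)⟩
    rw [hbez]
    ring
  · rintro ⟨u, v, rfl, hu⟩
    rw [map_add, map_mul]
    exact Submodule.add_mem_sup hu
      (Submodule.smul_mem _ _ (Submodule.mem_span_singleton_self _))
end

section
/- (First-order recurrence for ζ, Section 7.4.) For all real numbers a, b and every natural number m: (4m + 6)·ζ(m+1) + (m+1)·ζ(m) = (2b − 1)·(b² − b)^{m+1} − (2a − 1)·(a² − a)^{m+1}. -/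
theorem hasDerivAt_two_mul_sub_one_mul_pow (m : ℕ) (x : ℝ) :
    HasDerivAt (fun x : ℝ => (2 * x - 1) * (x ^ 2 - x) ^ (m + 1))
      ((4 * (m : ℝ) + 6) * (x ^ 2 - x) ^ (m + 1) + ((m : ℝ) + 1) * (x ^ 2 - x) ^ m) x := by
  have hlin : HasDerivAt (fun x : ℝ => 2 * x - 1) (2 * 1) x :=
    ((hasDerivAt_id' x).const_mul 2).sub_const 1
  have hquad : HasDerivAt (fun x : ℝ => x ^ 2 - x) (2 * x - 1) x := by
    simpa using (hasDerivAt_pow 2 x).fun_sub (hasDerivAt_id' x)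
  refine (hlin.fun_mul (hquad.fun_pow (m + 1))).congr_deriv ?_
  rw [Nat.add_sub_cancel]
  push_cast
  ring

/-- First-order recurrence for `ζ(m) = ∫_a^b (x² − x)^m dx` (Section 7.4):
`(4m + 6)·ζ(m+1) + (m+1)·ζ(m) = (2b − 1)(b² − b)^{m+1} − (2a − 1)(a² − a)^{m+1}`. -/
theorem zeta_first_order_recurrence (a b : ℝ) (m : ℕ) :
    (4 * (m : ℝ) + 6) * (∫ x in a..b, (x ^ 2 - x) ^ (m + 1)) +
        ((m : ℝ) + 1) * (∫ x in a..b, (x ^ 2 - x) ^ m) =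
      (2 * b - 1) * (b ^ 2 - b) ^ (m + 1) - (2 * a - 1) * (a ^ 2 - a) ^ (m + 1) := by
  have hint (c : ℝ) (n : ℕ) :
      IntervalIntegrable (fun x : ℝ => c * (x ^ 2 - x) ^ n) MeasureTheory.volume a b :=
    Continuous.intervalIntegrable (by fun_prop) a b
  rw [← intervalIntegral.integral_const_mul, ← intervalIntegral.integral_const_mul,
    ← intervalIntegral.integral_add (hint _ _) (hint _ _)]
  exact intervalIntegral.integral_eq_sub_of_hasDerivAt
    (fun x _ => hasDerivAt_two_mul_sub_one_mul_pow m x) ((hint _ _).add (hint _ _))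
end
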